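/- The configuration space Υ over a complete and separable metric space X is a closed subset of M₀⁺(X) endowed with the vague topology; in particular, Υ (with the subspace topology) is a Polish space. -/

import Mathlib

/-!
STATEMENT 0: The configuration space `Υ` over a complete and separable metric
space `X` is a closed subset of `M₀⁺(X)` endowed with the vague topology; in
particular, `Υ` (with the subspace topology) is a Polish space.
-/

open MeasureTheory Filter Topology ENNReal Set Bornology

noncomputable section

namespace PoissonTransport

section Core

variable {X : Type*} [MetricSpace X] [MeasurableSpace X] [BorelSpace X]

/-- A real-valued test function on the base space: continuous, bounded, and
vanishing outside a bounded set (the class `𝒞₀(X)` of the paper). -/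
def IsC0 (f : X → ℝ) : Prop :=
  Continuous f ∧ (∃ C : ℝ, ∀ x, |f x| ≤ C) ∧ ∃ B : Set X, IsBounded B ∧ ∀ x ∉ B, f x = 0

/-- A configuration: a Borel measure that is `ℕ ∪ {∞}`-valued and finite on
bounded (Borel) sets. -/
def IsConfiguration (η : Measure X) : Prop :=
  (∀ B : Set X, MeasurableSet B → η B = ⊤ ∨ ∃ n : ℕ, η B = (n : ℝ≥0∞)) ∧
  ∀ B : Set X, MeasurableSet B → IsBounded B → η B < ⊤

end Core

/-- The space `M₀⁺(X)` of nonnegative Borel measures finite on bounded sets. -/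
def M0plus (X : Type*) [MetricSpace X] [MeasurableSpace X] [BorelSpace X] : Type _ :=
  {μ : Measure X // ∀ B : Set X, MeasurableSet B → IsBounded B → μ B < ⊤}

/-- The vague topology on `M₀⁺(X)`: the initial topology of the maps
`μ ↦ ∫ f dμ` over `f ∈ 𝒞₀(X)`. -/
instance {X : Type*} [MetricSpace X] [MeasurableSpace X] [BorelSpace X] :
    TopologicalSpace (M0plus X) :=
  ⨅ f : {f : X → ℝ // IsC0 f},
    TopologicalSpace.induced (fun μ : M0plus X => ∫ x, f.1 x ∂μ.1) inferInstance

section FiniteMeasureTopology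

variable {Ω : Type*} [MeasurableSpace Ω] [TopologicalSpace Ω]

lemma eventually_measureReal_lt_of_isClosed [HasOuterApproxClosed Ω] [OpensMeasurableSpace Ω]
    (μ : FiniteMeasure Ω) {F : Set Ω} (hF : IsClosed F) {a : ℝ} (ha : (μ : Measure Ω).real F < a) :
    ∀ᶠ ν : FiniteMeasure Ω in 𝓝 μ, (ν : Measure Ω).real F < a := by
  have hlim := FiniteMeasure.limsup_measure_closed_le_of_tendsto
    (tendsto_id : Tendsto id (𝓝 μ) (𝓝 μ)) hF
  have hlt : (μ : Measure Ω) F < ENNReal.ofReal a :=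
    (ENNReal.lt_ofReal_iff_toReal_lt (measure_ne_top _ _)).2 ha
  filter_upwards [eventually_lt_of_limsup_lt (hlim.trans_lt hlt)] with ν hν
  exact (ENNReal.lt_ofReal_iff_toReal_lt (measure_ne_top _ _)).1 hν

lemma continuous_measureReal_univ [OpensMeasurableSpace Ω] :
    Continuous fun ν : FiniteMeasure Ω ↦ (ν : Measure Ω).real univ :=
  NNReal.continuous_coe.comp FiniteMeasure.continuous_mass

lemma eventually_lt_measureReal_of_isOpen [HasOuterApproxClosed Ω] [OpensMeasurableSpace Ω]
    (μ : FiniteMeasure Ω) {G : Set Ω} (hG : IsOpen G) {a : ℝ} (ha : a < (μ : Measure Ω).real G) :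
    ∀ᶠ ν : FiniteMeasure Ω in 𝓝 μ, a < (ν : Measure Ω).real G := by
  have hsum (ν : FiniteMeasure Ω) :
      (ν : Measure Ω).real G + (ν : Measure Ω).real Gᶜ = (ν : Measure Ω).real univ :=
    measureReal_add_measureReal_compl hG.measurableSet
  have h₁ := eventually_measureReal_lt_of_isClosed μ hG.isClosed_compl
    (a := (μ : Measure Ω).real Gᶜ + ((μ : Measure Ω).real G - a) / 2) (by linarith)
  have h₂ := ((continuous_measureReal_univ (Ω := Ω)).tendsto μ).eventually_const_lt
    (show (μ : Measure Ω).real univ - ((μ : Measure Ω).real G - a) / 2 < _ by linarith)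
  filter_upwards [h₁, h₂] with ν h₁ h₂
  linarith [hsum μ, hsum ν]

lemma tendsto_measureReal_of_null_frontier [HasOuterApproxClosed Ω] [OpensMeasurableSpace Ω]
    (μ : FiniteMeasure Ω) {G : Set Ω} (hG : (μ : Measure Ω) (frontier G) = 0) :
    Tendsto (fun ν : FiniteMeasure Ω ↦ (ν : Measure Ω).real G) (𝓝 μ)
      (𝓝 ((μ : Measure Ω).real G)) := by
  have hi : (μ : Measure Ω).real (interior G) = (μ : Measure Ω).real G :=
    measureReal_congr (interior_ae_eq_of_null_frontier hG)
  have hc : (μ : Measure Ω).real (closure G) = (μ : Measure Ω).real G :=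
    measureReal_congr (closure_ae_eq_of_null_frontier hG)
  refine tendsto_order.2 ⟨fun a ha ↦ ?_, fun a ha ↦ ?_⟩
  · filter_upwards [eventually_lt_measureReal_of_isOpen μ isOpen_interior (hi ▸ ha)] with ν hν
    exact hν.trans_le (measureReal_mono interior_subset)
  · filter_upwards [eventually_measureReal_lt_of_isClosed μ isClosed_closure (hc ▸ ha)] with ν hν
    exact (measureReal_mono subset_closure).trans_lt hν

lemma tendsto_of_forall_isOpen_eventually_lt [OpensMeasurableSpace Ω]
    {u : ℕ → FiniteMeasure Ω} {μ : FiniteMeasure Ω}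
    (hopen : ∀ G, IsOpen G → ∀ a < (μ : Measure Ω).real G,
      ∀ᶠ n in atTop, a < (u n : Measure Ω).real G)
    (hmass : ∀ a > (μ : Measure Ω).real univ, ∀ᶠ n in atTop, (u n : Measure Ω).real univ < a) :
    Tendsto u atTop (𝓝 μ) := by
  have hliminf (G : Set Ω) (hG : IsOpen G) :
      (μ : Measure Ω) G ≤ atTop.liminf fun n ↦ (u n : Measure Ω) G := by
    refine le_of_forall_lt fun b hb ↦ ?_
    obtain ⟨c, hbc, hc⟩ := exists_between hb
    refine hbc.trans_le (le_liminf_of_le (by isBoundedDefault) ?_)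
    have hctop : c ≠ ∞ := (hc.trans (measure_lt_top _ _)).ne
    filter_upwards [hopen G hG c.toReal
      ((ENNReal.toReal_lt_toReal hctop (measure_ne_top _ _)).2 hc)] with n hn
    exact ((ENNReal.toReal_lt_toReal hctop (measure_ne_top _ _)).1 hn).le
  have hmass' : Tendsto (fun n ↦ (u n : Measure Ω).real univ) atTop
      (𝓝 ((μ : Measure Ω).real univ)) :=
    tendsto_order.2 ⟨hopen univ isOpen_univ, hmass⟩
  have hlower (h : BoundedContinuousFunction Ω ℝ) (h0 : 0 ≤ (h : Ω → ℝ)) (a : ℝ)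
      (ha : a < ∫ x, h x ∂(μ : Measure Ω)) :
      ∀ᶠ n in atTop, a < ∫ x, h x ∂(u n : Measure Ω) := by
    have key := lintegral_le_liminf_lintegral_of_forall_isOpen_measure_le_liminf_measure
      h.continuous h0 hliminf
    have hofReal (ν : FiniteMeasure Ω) : ∫⁻ x, ENNReal.ofReal (h x) ∂(ν : Measure Ω) =
        ENNReal.ofReal (∫ x, h x ∂(ν : Measure Ω)) :=
      (ofReal_integral_eq_lintegral_ofReal (h.integrable _) (Eventually.of_forall h0)).symm
    simp only [hofReal] at key
    rcases lt_or_ge a 0 with ha0 | ha0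
    · exact Eventually.of_forall fun n ↦ ha0.trans_le (integral_nonneg h0)
    have hlt : ENNReal.ofReal a < ENNReal.ofReal (∫ x, h x ∂(μ : Measure Ω)) :=
      (ENNReal.ofReal_lt_ofReal_iff_of_nonneg ha0).2 ha
    filter_upwards [eventually_lt_of_lt_liminf (hlt.trans_le key)] with n hn
    exact (ENNReal.ofReal_lt_ofReal_iff_of_nonneg ha0).1 hn
  refine FiniteMeasure.tendsto_iff_forall_integral_tendsto.2 fun f ↦ ?_
  let c : BoundedContinuousFunction Ω ℝ := BoundedContinuousFunction.const Ω ‖f‖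
  have hc (ν : FiniteMeasure Ω) : ∫ x, c x ∂(ν : Measure Ω) = (ν : Measure Ω).real univ * ‖f‖ := by
    simp [c]
  have hadd (ν : FiniteMeasure Ω) : ∫ x, (c + f) x ∂(ν : Measure Ω) =
      (ν : Measure Ω).real univ * ‖f‖ + ∫ x, f x ∂(ν : Measure Ω) := by
    rw [← hc, ← integral_add (c.integrable _) (f.integrable _)]; rfl
  have hsub (ν : FiniteMeasure Ω) : ∫ x, (c - f) x ∂(ν : Measure Ω) =
      (ν : Measure Ω).real univ * ‖f‖ - ∫ x, f x ∂(ν : Measure Ω) := by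
    rw [← hc, ← integral_sub (c.integrable _) (f.integrable _)]; rfl
  have hm := hmass'.mul_const ‖f‖
  refine tendsto_order.2 ⟨fun a ha ↦ ?_, fun a ha ↦ ?_⟩
  · set δ := (∫ x, f x ∂(μ : Measure Ω)) - a with hδ
    have h₁ := hlower (c + f) (fun x ↦ by
      have := neg_le_of_abs_le (f.norm_coe_le_norm x)
      simp only [c, Pi.zero_apply, BoundedContinuousFunction.coe_add, Pi.add_apply,
        BoundedContinuousFunction.const_apply]
      linarith) ((μ : Measure Ω).real univ * ‖f‖ + a + δ / 2) (by rw [hadd]; linarith)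
    filter_upwards [h₁, hm.eventually_lt_const
      (show _ < (μ : Measure Ω).real univ * ‖f‖ + δ / 2 by linarith)] with n h₁ h₂
    rw [hadd] at h₁
    linarith
  · set δ := a - (∫ x, f x ∂(μ : Measure Ω)) with hδ
    have h₁ := hlower (c - f) (fun x ↦ by
      have := le_of_abs_le (f.norm_coe_le_norm x)
      simp only [c, Pi.zero_apply, BoundedContinuousFunction.coe_sub, Pi.sub_apply,
        BoundedContinuousFunction.const_apply]
      linarith) ((μ : Measure Ω).real univ * ‖f‖ - a + δ / 2) (by rw [hsub]; linarith)
    filter_upwards [h₁, hm.eventually_lt_const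
      (show _ < (μ : Measure Ω).real univ * ‖f‖ + δ / 2 by linarith)] with n h₁ h₂
    rw [hsub] at h₁
    linarith

lemma exists_finite_subset_lt_measureReal_sUnion {B : Set (Set Ω)}
    (hB : TopologicalSpace.IsTopologicalBasis B) (hBc : B.Countable)
    (μ : Measure Ω) [IsFiniteMeasure μ] {G : Set Ω} (hG : IsOpen G) {a : ℝ} (ha : a < μ.real G) :
    ∃ s ⊆ B, s.Finite ∧ ⋃₀ s ⊆ G ∧ a < μ.real (⋃₀ s) := by
  let C : Set (Set Ω) := {b ∈ B | b ⊆ G}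
  have : Countable C := (hBc.mono fun b hb ↦ hb.1).to_subtype
  let U : Finset C → Set Ω := fun F ↦ ⋃₀ (Subtype.val '' (F : Set C))
  have hU : Directed (· ⊆ ·) U := Monotone.directed_le fun F F' h ↦
    sUnion_subset_sUnion (image_mono (Finset.coe_subset.2 h))
  have hUG : ⋃ F, U F = G := by
    refine subset_antisymm (iUnion_subset fun F ↦ sUnion_subset ?_) fun x hx ↦ ?_
    · rintro _ ⟨b, -, rfl⟩
      exact b.2.2
    · obtain ⟨b, hb, hxb, hbG⟩ := hB.exists_subset_of_mem_open hx hG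
      exact mem_iUnion.2 ⟨{⟨b, hb, hbG⟩}, b, by simp, hxb⟩
  rcases lt_or_ge a 0 with ha0 | ha0
  · exact ⟨∅, empty_subset _, finite_empty, by simp, by simpa using ha0⟩
  have hlt : ENNReal.ofReal a < ⨆ F, μ (U F) := by
    rw [← hU.measure_iUnion, hUG]
    exact (ENNReal.ofReal_lt_iff_lt_toReal ha0 (measure_ne_top _ _)).2 ha
  obtain ⟨F, hF⟩ := lt_iSup_iff.1 hlt
  refine ⟨_, ?_, F.finite_toSet.image Subtype.val, (subset_iUnion U F).trans hUG.subset,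
    (ENNReal.ofReal_lt_iff_lt_toReal ha0 (measure_ne_top _ _)).1 hF⟩
  rintro _ ⟨b, -, rfl⟩
  exact b.2.1

instance secondCountableTopology_finiteMeasure [SecondCountableTopology Ω]
    [HasOuterApproxClosed Ω] [OpensMeasurableSpace Ω] :
    SecondCountableTopology (FiniteMeasure Ω) := by
  obtain ⟨B, hBc, -, hB⟩ := TopologicalSpace.exists_countable_basis Ω
  let S : Set (Set Ω) := {s | ∃ t ⊆ B, t.Finite ∧ s = ⋃₀ t}
  have hS : S.Countable := by
    have := (Set.countable_ofPred_finite_subset hBc).image (fun t ↦ ⋃₀ t)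
    refine this.mono ?_
    rintro _ ⟨t, ht, htf, rfl⟩
    exact ⟨t, ⟨htf, ht⟩, rfl⟩
  let lower : Set Ω × ℚ → Set (FiniteMeasure Ω) := fun p ↦
    {ν | (p.2 : ℝ) < (ν : Measure Ω).real p.1}
  let upper : ℚ → Set (FiniteMeasure Ω) := fun q ↦ {ν | (ν : Measure Ω).real univ < q}
  let g : Set (Set (FiniteMeasure Ω)) := lower '' (S ×ˢ univ) ∪ range upper
  have hg : g.Countable := ((hS.prod countable_univ).image _).union (countable_range _)
  refine ⟨g, hg, le_antisymm ?_ ?_⟩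
  · refine le_generateFrom ?_
    rintro _ (⟨⟨s, q⟩, ⟨⟨t, ht, -, rfl⟩, -⟩, rfl⟩ | ⟨q, rfl⟩)
    · refine isOpen_iff_mem_nhds.2 fun ν hν ↦ eventually_lt_measureReal_of_isOpen ν
        (isOpen_sUnion fun u hu ↦ hB.isOpen (ht hu)) hν
    · exact isOpen_lt continuous_measureReal_univ continuous_const
  · let τ : TopologicalSpace (FiniteMeasure Ω) := TopologicalSpace.generateFrom g
    have hτ : @SecondCountableTopology _ τ := ⟨g, hg, rfl⟩
    have hmem (V : Set (FiniteMeasure Ω)) (hV : V ∈ g) (μ : FiniteMeasure Ω) (hμ : μ ∈ V) :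
        V ∈ @nhds _ τ μ :=
      @IsOpen.mem_nhds _ τ μ V (TopologicalSpace.isOpen_generateFrom_of_mem hV) hμ
    refine le_of_nhds_le_nhds fun μ ↦ ?_
    have : (@nhds _ τ μ).IsCountablyGenerated :=
      @FirstCountableTopology.nhds_generated_countable _ τ
        (@TopologicalSpace.SecondCountableTopology.to_firstCountableTopology _ τ hτ) μ
    refine tendsto_id'.1 (tendsto_of_seq_tendsto fun u hu ↦ ?_)
    refine tendsto_of_forall_isOpen_eventually_lt (fun G hG a ha ↦ ?_) fun a ha ↦ ?_
    · obtain ⟨q, haq, hq⟩ := exists_rat_btwn ha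
      obtain ⟨t, ht, htf, htG, hqt⟩ :=
        exists_finite_subset_lt_measureReal_sUnion hB hBc (μ : Measure Ω) hG hq
      filter_upwards [hu (hmem _ (Or.inl ⟨(⋃₀ t, q), ⟨⟨t, ht, htf, rfl⟩, mem_univ _⟩, rfl⟩) μ hqt)]
        with n hn
      exact haq.trans (hn.trans_le (measureReal_mono htG))
    · obtain ⟨q, hq, hqa⟩ := exists_rat_btwn ha
      filter_upwards [hu (hmem _ (Or.inr ⟨q, rfl⟩) μ hq)] with n hn
      exact hn.trans hqa

instance t3Space_finiteMeasure [HasOuterApproxClosed Ω] [BorelSpace Ω] :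
    T3Space (FiniteMeasure Ω) := by
  have : RegularSpace (WeakDual NNReal (BoundedContinuousFunction Ω NNReal)) :=
    (show IsInducing (fun (φ : WeakDual NNReal (BoundedContinuousFunction Ω NNReal)) f ↦ φ f) from
      ⟨rfl⟩).regularSpace
  have := (FiniteMeasure.isEmbedding_toWeakDualBCNN Ω).isInducing.regularSpace
  infer_instance

end FiniteMeasureTopology

/-- A space that embeds in a Polish space as a countable intersection of open sets is Polish. -/
lemma polishSpace_of_range_eq_iInter {Z Y : Type*} [TopologicalSpace Z] [TopologicalSpace Y]
    [PolishSpace Y] {e : Z → Y} (he : IsEmbedding e) {W : ℕ → Set Y} (hW : ∀ n, IsOpen (W n))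
    (hrange : range e = ⋂ n, W n) : PolishSpace Z := by
  have hmem (z : Z) (n : ℕ) : e z ∈ W n := mem_iInter.1 (hrange ▸ mem_range_self z) n
  have (n : ℕ) : PolishSpace (W n) := (hW n).polishSpace
  let d : Z → ∀ n, W n := fun z n ↦ ⟨e z, hmem z n⟩
  have hd : IsEmbedding d := by
    refine IsEmbedding.of_comp (f := d) (g := fun y ↦ ((y 0 : W 0) : Y)) ?_ ?_ he
    · exact continuous_pi fun n ↦ he.continuous.subtype_mk _
    · exact continuous_subtype_val.comp (continuous_apply 0)
  have hclosed : range d = {y | ∀ n, ((y n : W n) : Y) = (y 0 : W 0)} := by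
    ext y
    refine ⟨?_, fun hy ↦ ?_⟩
    · rintro ⟨z, rfl⟩ n
      rfl
    · have h0 : ((y 0 : W 0) : Y) ∈ range e :=
        hrange ▸ mem_iInter.2 fun n ↦ hy n ▸ (y n).2
      obtain ⟨z, hz⟩ := h0
      exact ⟨z, funext fun n ↦ Subtype.ext (hz.trans (hy n).symm)⟩
  refine (IsClosedEmbedding.mk hd ?_).polishSpace
  rw [hclosed]
  simp only [ofPred_forall]
  exact isClosed_iInter fun n ↦ isClosed_eq (continuous_subtype_val.comp (continuous_apply n))
    (continuous_subtype_val.comp (continuous_apply 0))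

lemma isCompact_iInter_iUnion_closedBall {X : Type*} [MetricSpace X] [CompleteSpace X]
    {S : ℕ → Set X} (hS : ∀ m, (S m).Finite) (k : ℕ) :
    IsCompact (⋂ j, ⋃ x ∈ S (j + k), Metric.closedBall x ((1 / 2 : ℝ) ^ (j + k))) := by
  refine TotallyBounded.isCompact_of_isClosed (Metric.totallyBounded_iff.2 fun ε hε ↦ ?_)
    (isClosed_iInter fun j ↦ (hS _).isClosed_biUnion fun _ _ ↦ Metric.isClosed_closedBall)
  obtain ⟨j, hj⟩ := exists_pow_lt_of_lt_one hε (show (1 / 2 : ℝ) < 1 by norm_num)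
  have hjk : (1 / 2 : ℝ) ^ (j + k) < ε :=
    (pow_le_pow_of_le_one (by norm_num) (by norm_num) (Nat.le_add_right j k)).trans_lt hj
  exact ⟨S (j + k), hS _, (iInter_subset _ j).trans
    (biUnion_mono subset_rfl fun x _ ↦ Metric.closedBall_subset_ball hjk)⟩

section FiniteMeasurePolish

variable {X : Type*} [MetricSpace X] [MeasurableSpace X] [BorelSpace X]

lemma exists_finite_measure_compl_iUnion_ball_lt [TopologicalSpace.SeparableSpace X]
    (μ : Measure X) [IsFiniteMeasure μ] {r ε : ℝ} (hr : 0 < r) (hε : 0 < ε) :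
    ∃ S : Set X, S.Finite ∧ μ.real (⋃ x ∈ S, Metric.ball x r)ᶜ < ε := by
  obtain ⟨D, hDc, hD⟩ := TopologicalSpace.exists_countable_dense X
  have : Countable D := hDc.to_subtype
  let U : Finset D → Set X := fun F ↦ ⋃ x ∈ Subtype.val '' (F : Set D), Metric.ball x r
  have hU : Monotone U := fun F F' h ↦
    biUnion_mono (image_mono (Finset.coe_subset.2 h)) fun _ _ ↦ subset_rfl
  have hUopen (F : Finset D) : IsOpen (U F) := isOpen_biUnion fun _ _ ↦ Metric.isOpen_ball
  have hUuniv : ⋃ F, U F = univ := by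
    refine eq_univ_of_forall fun x ↦ ?_
    obtain ⟨y, hy, hxy⟩ := hD.exists_dist_lt x hr
    exact mem_iUnion.2 ⟨{⟨y, hy⟩}, by simpa [U] using ⟨hy, hxy⟩⟩
  have hlim := tendsto_measure_iUnion_atTop (μ := μ) hU
  rw [hUuniv] at hlim
  have hlim' : Tendsto (fun F ↦ μ.real (U F)) atTop (𝓝 (μ.real univ)) :=
    (ENNReal.tendsto_toReal (measure_ne_top _ _)).comp hlim
  obtain ⟨F, hF⟩ := (hlim'.eventually_const_lt (sub_lt_self _ hε)).exists
  refine ⟨_, F.finite_toSet.image Subtype.val, ?_⟩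
  have := measureReal_add_measureReal_compl (μ := μ) (hUopen F).measurableSet
  change μ.real (U F)ᶜ < ε
  linarith

lemma exists_mapClusterPt_of_measure_compl_iUnion_closedBall_le [CompleteSpace X]
    {z : ℕ → FiniteMeasure X} {C : NNReal} (hC : ∀ n, (z n).mass ≤ C) {S : ℕ → Set X}
    (hS : ∀ m, (S m).Finite)
    (h : ∀ n m, (z n : Measure X) (⋃ x ∈ S m, Metric.closedBall x ((1 / 2 : ℝ) ^ m))ᶜ
      ≤ (2⁻¹ : ℝ≥0∞) ^ m) :
    ∃ μ, MapClusterPt μ atTop z := by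
  let u : ℕ → NNReal := fun k ↦ 2 * 2⁻¹ ^ k
  have hu : Tendsto u atTop (𝓝 0) := by
    simpa [u] using (NNReal.tendsto_pow_atTop_nhds_zero_of_lt_one
      (r := 2⁻¹) (by norm_num)).const_mul 2
  have hcompact := isCompact_setOfPred_finiteMeasure_mass_le_compl_isCompact_le C hu
    (isCompact_iInter_iUnion_closedBall hS) (Or.inl inferInstance)
  have hmem (n : ℕ) : z n ∈ {μ : FiniteMeasure X | μ.mass ≤ C ∧ ∀ k,
      μ (⋂ j, ⋃ x ∈ S (j + k), Metric.closedBall x ((1 / 2 : ℝ) ^ (j + k)))ᶜ ≤ u k} := by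
    refine ⟨hC n, fun k ↦ ?_⟩
    rw [← ENNReal.coe_le_coe, FiniteMeasure.ennreal_coeFn_eq_coeFn_toMeasure, compl_iInter]
    calc (z n : Measure X) _
        ≤ ∑' j, (z n : Measure X)
          (⋃ x ∈ S (j + k), Metric.closedBall x ((1 / 2 : ℝ) ^ (j + k)))ᶜ := measure_iUnion_le _
      _ ≤ ∑' j, (2⁻¹ : ℝ≥0∞) ^ (j + k) := ENNReal.tsum_le_tsum fun j ↦ h n _
      _ = u k := by
        simp [u, pow_add, ENNReal.tsum_mul_right, ENNReal.tsum_geometric, ENNReal.one_sub_inv_two,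
          ENNReal.inv_pow]
  obtain ⟨μ, -, hμ⟩ := hcompact.exists_mapClusterPt (f := atTop) (u := z)
    (le_principal_iff.2 (mem_map.2 (Eventually.of_forall hmem)))
  exact ⟨μ, hμ⟩

instance polishSpace_finiteMeasure [CompleteSpace X] [TopologicalSpace.SeparableSpace X] :
    PolishSpace (FiniteMeasure X) := by
  have : SecondCountableTopology X := UniformSpace.secondCountable_of_separable X
  let : MetricSpace (FiniteMeasure X) := TopologicalSpace.metrizableSpaceMetric _
  let Y := UniformSpace.Completion (FiniteMeasure X)
  let e : FiniteMeasure X → Y := (↑)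
  have he : IsEmbedding e := UniformSpace.Completion.coe_isometry.isEmbedding
  let T : Set X → ℕ → Set X := fun S m ↦ ⋃ x ∈ S, Metric.closedBall x ((1 / 2 : ℝ) ^ m)
  let P : ℕ → Set Y → Prop := fun m V ↦ IsOpen V ∧ ∃ (C : NNReal) (S : Set X), S.Finite ∧
    ∀ ν, e ν ∈ V → ν.mass ≤ C ∧ (ν : Measure X) (T S m)ᶜ ≤ (2⁻¹ : ℝ≥0∞) ^ m
  have hpow (m : ℕ) (ν : FiniteMeasure X) {A B : Set X} (hAB : A ⊆ B)
      (hA : (ν : Measure X).real Aᶜ < (1 / 2) ^ m) : (ν : Measure X) Bᶜ ≤ (2⁻¹ : ℝ≥0∞) ^ m := by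
    refine (measure_mono (compl_subset_compl.2 hAB)).trans ?_
    have := ((ENNReal.lt_ofReal_iff_toReal_lt (measure_ne_top _ _)).2 hA).le
    rwa [ENNReal.ofReal_pow (by norm_num), one_div, ENNReal.ofReal_inv_of_pos (by norm_num),
      ENNReal.ofReal_ofNat] at this
  have hball (S : Set X) (m : ℕ) : ⋃ x ∈ S, Metric.ball x ((1 / 2 : ℝ) ^ m) ⊆ T S m :=
    biUnion_mono subset_rfl fun _ _ ↦ Metric.ball_subset_closedBall
  refine polishSpace_of_range_eq_iInter he (W := fun m ↦ ⋃₀ {V | P m V})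
    (fun m ↦ isOpen_sUnion fun V hV ↦ hV.1) (subset_antisymm ?_ fun y hy ↦ ?_)
  · rintro _ ⟨μ, rfl⟩
    refine mem_iInter.2 fun m ↦ ?_
    obtain ⟨S, hS, hμS⟩ := exists_finite_measure_compl_iUnion_ball_lt (μ : Measure X)
      (r := (1 / 2) ^ m) (ε := (1 / 2) ^ m) (by positivity) (by positivity)
    have h₁ := eventually_measureReal_lt_of_isClosed μ
      (isOpen_biUnion fun _ _ ↦ Metric.isOpen_ball).isClosed_compl hμS
    have h₂ := (FiniteMeasure.continuous_mass.tendsto μ).eventually_lt_const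
      (lt_add_one μ.mass)
    have h₃ := h₁.and h₂
    rw [he.isInducing.nhds_eq_comap, eventually_comap] at h₃
    obtain ⟨V, hV, hVo, hμV⟩ := eventually_nhds_iff.1 h₃
    exact ⟨V, ⟨hVo, μ.mass + 1, S, hS, fun ν hν ↦
      ⟨(hV _ hν ν rfl).2.le, hpow m ν (hball S m) (hV _ hν ν rfl).1⟩⟩, hμV⟩
  · simp only [mem_iInter] at hy
    choose V hV hyV using hy
    choose hVo C S hS hVS using hV
    have hz (n : ℕ) : ∃ ν, e ν ∈ (⋂ m ∈ Finset.range (n + 1), V m) ∩ Metric.ball y (1 / (n + 1)) :=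
      UniformSpace.Completion.denseRange_coe.exists_mem_open
        ((isOpen_biInter_finset fun m _ ↦ hVo m).inter Metric.isOpen_ball)
        ⟨y, mem_iInter₂.2 fun m _ ↦ hyV m, Metric.mem_ball_self (by positivity)⟩
    choose z hz using hz
    have hzV (n m : ℕ) (hm : m ≤ n) : e (z n) ∈ V m :=
      mem_iInter₂.1 (hz n).1 m (Finset.mem_range.2 (by omega))
    have hlim : Tendsto (fun n ↦ e (z n)) atTop (𝓝 y) :=
      tendsto_iff_dist_tendsto_zero.2 (squeeze_zero (fun _ ↦ dist_nonneg)
        (fun n ↦ (Metric.mem_ball.1 (hz n).2).le) tendsto_one_div_add_atTop_nhds_zero_nat)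
    choose S' hS' hzS' using fun n m : ℕ ↦ exists_finite_measure_compl_iUnion_ball_lt
      (z n : Measure X) (r := (1 / 2) ^ m) (ε := (1 / 2) ^ m) (by positivity) (by positivity)
    obtain ⟨μ, hμ⟩ := exists_mapClusterPt_of_measure_compl_iUnion_closedBall_le
      (z := z) (C := C 0) (fun n ↦ (hVS 0 _ (hzV n 0 n.zero_le)).1)
      (S := fun m ↦ S m ∪ ⋃ n ∈ Finset.range m, S' n m)
      (fun m ↦ (hS m).union ((Finset.range m).finite_toSet.biUnion fun n _ ↦ hS' n m))
      (fun n m ↦ by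
        rcases le_or_gt m n with hmn | hmn
        · exact (measure_mono (compl_subset_compl.2
            (biUnion_subset_biUnion_left subset_union_left))).trans (hVS m _ (hzV n m hmn)).2
        · refine hpow m _ ((hball _ _).trans (biUnion_subset_biUnion_left ?_)) (hzS' n m)
          exact subset_union_of_subset_right
            (subset_biUnion_of_mem (u := fun n ↦ S' n m) (Finset.mem_range.2 hmn)) _)
    refine ⟨μ, ?_⟩
    have hμ' : MapClusterPt (e μ) atTop (fun n ↦ e (z n)) :=
      hμ.continuousAt_comp he.continuous.continuousAt
    exact eq_of_nhds_neBot (NeBot.mono hμ' (inf_le_inf_left _ hlim))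

end FiniteMeasurePolish

section Localization

variable {X : Type*} [MetricSpace X]

/-- The distance to a fixed base point; `Classical.choice` does not depend on the proof `⟨x⟩`. -/
def gauge (x : X) : ℝ := dist x (Classical.choice ⟨x⟩)

lemma continuous_gauge : Continuous (gauge : X → ℝ) := by
  rcases isEmpty_or_nonempty X with h | h
  · exact continuous_of_const fun x ↦ isEmptyElim x
  · exact continuous_id.dist (continuous_const (y := Classical.choice h))

lemma isBounded_gauge_le (r : ℝ) : IsBounded {x : X | gauge x ≤ r} := by
  rcases isEmpty_or_nonempty X with h | h
  · rw [Set.eq_empty_of_isEmpty {x : X | gauge x ≤ r}]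
    exact isBounded_empty
  · exact Metric.isBounded_closedBall (x := Classical.choice h) (r := r)

lemma exists_nat_gauge_le {B : Set X} (hB : IsBounded B) : ∃ n : ℕ, ∀ x ∈ B, gauge x ≤ n := by
  rcases isEmpty_or_nonempty X with h | h
  · exact ⟨0, fun x ↦ isEmptyElim x⟩
  · obtain ⟨r, hr⟩ := hB.subset_closedBall (Classical.choice h)
    obtain ⟨n, hn⟩ := exists_nat_ge r
    exact ⟨n, fun x hx ↦ (hr hx).trans hn⟩

/-- A continuous cutoff, equal to one where `gauge ≤ n` and zero where `n + 1 ≤ gauge`. -/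
def cutoff (n : ℕ) (x : X) : NNReal := Real.toNNReal (min 1 (n + 1 - gauge x))

lemma continuous_cutoff (n : ℕ) : Continuous (cutoff n : X → NNReal) :=
  continuous_real_toNNReal.comp
    (continuous_const.min (continuous_const.sub continuous_gauge))

lemma cutoff_le_one (n : ℕ) (x : X) : cutoff n x ≤ 1 := by
  simp [cutoff]

lemma cutoff_eq_one {n : ℕ} {x : X} (h : gauge x ≤ n) : cutoff n x = 1 := by
  rw [cutoff, min_eq_left (by linarith), Real.toNNReal_one]

lemma cutoff_eq_zero {n : ℕ} {x : X} (h : (n : ℝ) + 1 ≤ gauge x) : cutoff n x = 0 :=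
  Real.toNNReal_of_nonpos ((min_le_right _ _).trans (by linarith))

lemma isC0_cutoff_mul (n : ℕ) {f : X → ℝ} (hf : Continuous f) {C : ℝ} (hC : ∀ x, |f x| ≤ C) :
    IsC0 fun x ↦ (cutoff n x : ℝ) * f x := by
  refine ⟨(NNReal.continuous_coe.comp (continuous_cutoff n)).mul hf, ⟨C, fun x ↦ ?_⟩,
    _, isBounded_gauge_le ((n : ℝ) + 1), fun x hx ↦ ?_⟩
  · rw [abs_mul, NNReal.abs_eq]
    have h1 : (cutoff n x : ℝ) ≤ 1 := mod_cast cutoff_le_one n x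
    exact (mul_le_of_le_one_left (abs_nonneg _) h1).trans (hC x)
  · have hx' : ¬ gauge x ≤ (n : ℝ) + 1 := hx
    simp [cutoff_eq_zero (not_le.1 hx').le]

variable [MeasurableSpace X] [BorelSpace X]

lemma measurableSet_gauge_le (r : ℝ) : MeasurableSet {x : X | gauge x ≤ r} :=
  (isClosed_le continuous_gauge continuous_const).measurableSet

lemma measurable_coe_cutoff (n : ℕ) : Measurable fun x : X ↦ (cutoff n x : ℝ≥0∞) :=
  (continuous_cutoff n).measurable.coe_nnreal_ennreal

lemma withDensity_cutoff_eq_restrict (μ : Measure X) (n : ℕ) :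
    μ.withDensity (fun x ↦ (cutoff n x : ℝ≥0∞)) =
      (μ.restrict {x | gauge x ≤ (n + 1 : ℕ)}).withDensity (fun x ↦ (cutoff n x : ℝ≥0∞)) := by
  rw [← withDensity_indicator (measurableSet_gauge_le _)]
  congr 1
  ext1 x
  by_cases hx : x ∈ {x : X | gauge x ≤ (n + 1 : ℕ)}
  · rw [Set.indicator_of_mem hx]
  · rw [Set.indicator_of_notMem hx, cutoff_eq_zero, ENNReal.coe_zero]
    have hx' : ¬ gauge x ≤ ((n + 1 : ℕ) : ℝ) := hx
    push_cast at hx'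
    exact (not_le.1 hx').le

/-- The finite measure with density `cutoff n` with respect to `μ`. -/
def localize (n : ℕ) (μ : M0plus X) : FiniteMeasure X :=
  ⟨μ.1.withDensity fun x ↦ (cutoff n x : ℝ≥0∞), by
    refine ⟨?_⟩
    rw [withDensity_cutoff_eq_restrict, withDensity_apply _ MeasurableSet.univ,
      Measure.restrict_univ]
    calc ∫⁻ x, (cutoff n x : ℝ≥0∞) ∂(μ.1.restrict {x | gauge x ≤ (n + 1 : ℕ)})
        ≤ ∫⁻ _, 1 ∂(μ.1.restrict {x | gauge x ≤ (n + 1 : ℕ)}) :=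
          lintegral_mono fun x ↦ ENNReal.coe_le_one_iff.2 (cutoff_le_one n x)
      _ < ⊤ := by
          rw [lintegral_one, Measure.restrict_apply_univ]
          exact μ.2 _ (measurableSet_gauge_le _) (isBounded_gauge_le _)⟩

lemma localize_apply {n : ℕ} (μ : M0plus X) {A : Set X} (hA : MeasurableSet A)
    (hAn : ∀ x ∈ A, gauge x ≤ n) : (localize n μ : Measure X) A = μ.1 A := by
  change μ.1.withDensity (fun x ↦ (cutoff n x : ℝ≥0∞)) A = μ.1 A
  rw [withDensity_apply _ hA, setLIntegral_congr_fun (g := fun _ ↦ 1) hA, setLIntegral_one]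
  intro x hx
  simp [cutoff_eq_one (hAn x hx)]

lemma localize_congr {n : ℕ} {μ ν : M0plus X}
    (h : ∀ A, MeasurableSet A → (∀ x ∈ A, gauge x ≤ (n + 1 : ℕ)) → μ.1 A = ν.1 A) :
    localize n μ = localize n ν := by
  apply Subtype.ext
  change μ.1.withDensity _ = ν.1.withDensity _
  rw [withDensity_cutoff_eq_restrict μ.1, withDensity_cutoff_eq_restrict ν.1]
  congr 1
  ext A hA
  rw [Measure.restrict_apply hA, Measure.restrict_apply hA]
  exact h _ (hA.inter (measurableSet_gauge_le _)) fun x hx ↦ hx.2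

lemma ext_of_localize {μ ν : M0plus X} (h : ∀ n, localize n μ = localize n ν) : μ = ν := by
  apply Subtype.ext
  ext A hA
  have key (κ : Measure X) : κ A = ⨆ n : ℕ, κ (A ∩ {x | gauge x ≤ n}) := by
    rw [← Monotone.measure_iUnion, ← Set.inter_iUnion]
    · congr 1
      refine (Set.inter_eq_left.2 fun x _ ↦ ?_).symm
      exact Set.mem_iUnion.2 (exists_nat_ge (gauge x))
    · intro m n hmn x hx
      exact ⟨hx.1, show gauge x ≤ n from le_trans hx.2 (Nat.cast_le.2 hmn)⟩
  rw [key μ.1, key ν.1]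
  refine iSup_congr fun n ↦ ?_
  have hm : MeasurableSet (A ∩ {x | gauge x ≤ (n : ℝ)}) := hA.inter (measurableSet_gauge_le _)
  rw [← localize_apply μ hm fun x hx ↦ hx.2, ← localize_apply ν hm fun x hx ↦ hx.2, h n]

lemma integral_localize (n : ℕ) (μ : M0plus X) (f : X → ℝ) :
    ∫ x, f x ∂(localize n μ : Measure X) = ∫ x, (cutoff n x : ℝ) * f x ∂μ.1 := by
  change ∫ x, f x ∂(μ.1.withDensity fun x ↦ (cutoff n x : ℝ≥0∞)) = _
  rw [integral_withDensity_eq_integral_smul (continuous_cutoff n).measurable]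
  rfl

lemma continuous_integral_of_isC0 {f : X → ℝ} (hf : IsC0 f) :
    Continuous fun μ : M0plus X ↦ ∫ x, f x ∂μ.1 :=
  continuous_iInf_dom (i := ⟨f, hf⟩) continuous_induced_dom

lemma continuous_localize (n : ℕ) : Continuous (localize n : M0plus X → FiniteMeasure X) := by
  rw [FiniteMeasure.continuous_iff_forall_continuous_integral]
  intro f
  simp only [integral_localize]
  exact continuous_integral_of_isC0
    (isC0_cutoff_mul n f.continuous (C := ‖f‖) fun x ↦ f.norm_coe_le_norm x)

/-- A finite measure as an element of `M0plus X`. -/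
def ofFiniteMeasure (ν : FiniteMeasure X) : M0plus X :=
  ⟨(ν : Measure X), fun _ _ _ ↦ measure_lt_top _ _⟩

lemma continuous_ofFiniteMeasure :
    Continuous (ofFiniteMeasure : FiniteMeasure X → M0plus X) := by
  refine continuous_iInf_rng.2 fun f ↦ continuous_induced_rng.2 ?_
  obtain ⟨f, hf, ⟨C, hC⟩, -⟩ := f
  exact FiniteMeasure.continuous_iff_forall_continuous_integral.1 continuous_id
    (BoundedContinuousFunction.ofNormedAddCommGroup f hf C hC)

lemma isInducing_localize :
    IsInducing fun (μ : M0plus X) (n : ℕ) ↦ localize n μ := by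
  refine ⟨le_antisymm (continuous_pi continuous_localize).le_induced ?_⟩
  refine le_iInf fun f ↦ ?_
  obtain ⟨f, hf, ⟨C, hC⟩, B, hB, hfB⟩ := f
  obtain ⟨n, hn⟩ := exists_nat_gauge_le hB
  let g := BoundedContinuousFunction.ofNormedAddCommGroup f hf C hC
  have hcont : Continuous fun ν : ℕ → FiniteMeasure X ↦ ∫ x, g x ∂(ν n : Measure X) :=
    FiniteMeasure.continuous_iff_forall_continuous_integral.1 (continuous_apply n) g
  have heq : (fun μ : M0plus X ↦ ∫ x, f x ∂μ.1) =
      (fun ν : ℕ → FiniteMeasure X ↦ ∫ x, g x ∂(ν n : Measure X)) ∘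
        fun (μ : M0plus X) (n : ℕ) ↦ localize n μ := by
    ext μ
    simp only [Function.comp_apply, integral_localize]
    refine integral_congr_ae (.of_forall fun x ↦ ?_)
    change f x = cutoff n x * f x
    by_cases hx : x ∈ B
    · rw [cutoff_eq_one (hn x hx), NNReal.coe_one, one_mul]
    · rw [hfB x hx, mul_zero]
  change _ ≤ TopologicalSpace.induced (fun μ : M0plus X ↦ ∫ x, f x ∂μ.1) _
  rw [heq, ← induced_compose]
  exact induced_mono hcont.le_induced

lemma exists_localize_eq {ν : ℕ → FiniteMeasure X}
    (hν : ∀ n, localize n (ofFiniteMeasure (ν (n + 1))) = ν n) :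
    ∃ μ : M0plus X, ∀ n, localize n μ = ν n := by
  let S : ℕ → Set X := fun n ↦ {x | gauge x ≤ n}
  have hS : ∀ n, MeasurableSet (S n) := fun n ↦ measurableSet_gauge_le _
  have hSm : Monotone S := fun m n hmn x hx ↦
    show gauge x ≤ n from le_trans hx (Nat.cast_le.2 hmn)
  have hstep : ∀ n A, MeasurableSet A → A ⊆ S n →
      (ν (n + 1) : Measure X) A = (ν n : Measure X) A := fun n A hA hAn ↦ by
    rw [← hν n, localize_apply _ hA hAn]
    rfl
  have hagree : ∀ k n A, MeasurableSet A → A ⊆ S k → k ≤ n →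
      (ν n : Measure X) A = (ν k : Measure X) A := fun k n A hA hAk hkn ↦ by
    induction n, hkn using Nat.le_induction with
    | base => rfl
    | succ n hkn ih => rw [hstep n A hA (hAk.trans (hSm hkn)), ih]
  let κ : Measure X := Measure.sum fun k ↦ (ν k : Measure X).restrict (disjointed S k)
  have hdm : ∀ k, MeasurableSet (disjointed S k) := MeasurableSet.disjointed hS
  have hκ : ∀ n A, MeasurableSet A → A ⊆ S n → κ A = (ν n : Measure X) A := fun n A hA hAn ↦ by
    have hU : A = ⋃ k, A ∩ disjointed S k := by
      rw [← Set.inter_iUnion, iUnion_disjointed]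
      exact (Set.inter_eq_left.2 (hAn.trans (Set.subset_iUnion S n))).symm
    conv_rhs => rw [hU]
    rw [measure_iUnion (fun i j hij ↦ ((disjoint_disjointed S hij).mono
      Set.inter_subset_right Set.inter_subset_right)) fun k ↦ hA.inter (hdm k),
      Measure.sum_apply _ hA]
    refine tsum_congr fun k ↦ ?_
    rw [Measure.restrict_apply hA]
    rcases le_total k n with hkn | hkn
    · exact (hagree k n _ (hA.inter (hdm k))
        (Set.inter_subset_right.trans (disjointed_subset S k)) hkn).symm
    · exact hagree n k _ (hA.inter (hdm k)) (Set.inter_subset_left.trans hAn) hkn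
  refine ⟨⟨κ, fun B hB hBb ↦ ?_⟩, fun n ↦ ?_⟩
  · obtain ⟨n, hn⟩ := exists_nat_gauge_le hBb
    rw [hκ n B hB hn]
    exact measure_lt_top _ _
  · rw [← hν n]
    exact localize_congr fun A hA hAn ↦ hκ (n + 1) A hA hAn

lemma isClosedEmbedding_localize :
    IsClosedEmbedding fun (μ : M0plus X) (n : ℕ) ↦ localize n μ := by
  refine ⟨⟨isInducing_localize, fun μ ν h ↦ ext_of_localize (congrFun h)⟩, ?_⟩
  have hrange : Set.range (fun (μ : M0plus X) (n : ℕ) ↦ localize n μ) =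
      {ν | ∀ n, localize n (ofFiniteMeasure (ν (n + 1))) = ν n} := by
    ext ν
    constructor
    · rintro ⟨μ, rfl⟩ n
      exact localize_congr fun A hA hAn ↦ localize_apply μ hA hAn
    · intro hν
      obtain ⟨μ, hμ⟩ := exists_localize_eq hν
      exact ⟨μ, funext hμ⟩
  rw [hrange, Set.ofPred_forall]
  exact isClosed_iInter fun n ↦ isClosed_eq
    ((continuous_localize n).comp (continuous_ofFiniteMeasure.comp (continuous_apply _)))
    (continuous_apply n)

instance polishSpace_M0plus [CompleteSpace X] [TopologicalSpace.SeparableSpace X] :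
    PolishSpace (M0plus X) :=
  isClosedEmbedding_localize.polishSpace

end Localization

section Configurations

lemma mem_range_toENNReal_iff {a : ℝ≥0∞} :
    a ∈ Set.range ENat.toENNReal ↔ a = ⊤ ∨ ∃ n : ℕ, a = n := by
  constructor
  · rintro ⟨m, rfl⟩
    induction m using ENat.recTopCoe with
    | top => exact .inl ENat.toENNReal_top
    | coe n => exact .inr ⟨n, ENat.toENNReal_coe n⟩
  · rintro (rfl | ⟨n, rfl⟩)
    · exact ⟨⊤, ENat.toENNReal_top⟩
    · exact ⟨n, ENat.toENNReal_coe n⟩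

lemma tsum_mem_range_toENNReal {a : ℕ → ℝ≥0∞} (ha : ∀ i, a i ∈ Set.range ENat.toENNReal) :
    ∑' i, a i ∈ Set.range ENat.toENNReal := by
  choose m hm using ha
  refine ENat.isClosedEmbedding_toENNReal.isClosed_range.mem_of_tendsto
    ENNReal.summable.hasSum.tendsto_sum_nat (.of_forall fun n ↦ ⟨∑ i ∈ Finset.range n, m i, ?_⟩)
  rw [← ENat.toENNRealRingHom_apply, map_sum]
  exact Finset.sum_congr rfl fun i _ ↦ hm i

lemma sub_mem_range_toENNReal {a b : ℝ≥0∞} (ha : a ∈ Set.range ENat.toENNReal)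
    (hb : b ∈ Set.range ENat.toENNReal) : a - b ∈ Set.range ENat.toENNReal := by
  obtain ⟨m, rfl⟩ := ha
  obtain ⟨n, rfl⟩ := hb
  exact ⟨m - n, ENat.toENNReal_sub m n⟩

variable {X : Type*} [MeasurableSpace X]

/-- A measure that is integer-valued on the traces of a π-system on a set of finite measure is
integer-valued on the traces of all sets in the generated σ-algebra. -/
lemma measure_inter_mem_range_toENNReal {μ : Measure X} {C : Set (Set X)}
    (hgen : ‹MeasurableSpace X› = MeasurableSpace.generateFrom C) (hpi : IsPiSystem C)
    {D : Set X} (hDm : MeasurableSet D) (hDfin : μ D ≠ ⊤)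
    (hD : μ D ∈ Set.range ENat.toENNReal)
    (hC : ∀ A ∈ C, μ (A ∩ D) ∈ Set.range ENat.toENNReal) {A : Set X} (hA : MeasurableSet A) :
    μ (A ∩ D) ∈ Set.range ENat.toENNReal := by
  induction A, hA using MeasurableSpace.induction_on_inter hgen hpi with
  | empty => simp
  | basic A hA => exact hC A hA
  | compl A hA ih =>
    have hfin : μ (A ∩ D) ≠ ⊤ := measure_ne_top_of_subset Set.inter_subset_right hDfin
    have heq : Aᶜ ∩ D = D \ (A ∩ D) := by
      ext x
      simp only [Set.mem_inter_iff, Set.mem_compl_iff, Set.mem_sdiff]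
      tauto
    rw [heq, measure_sdiff Set.inter_subset_right (hA.inter hDm).nullMeasurableSet hfin]
    exact sub_mem_range_toENNReal hD ih
  | iUnion A hdisj hA ih =>
    rw [Set.iUnion_inter, measure_iUnion (fun i j hij ↦ (hdisj hij).mono
      Set.inter_subset_left Set.inter_subset_left) fun i ↦ (hA i).inter hDm]
    exact tsum_mem_range_toENNReal ih

lemma exists_measure_frontier_lt_eq_zero [TopologicalSpace X] [BorelSpace X] (μ : Measure X)
    [SFinite μ] {g : X → ℝ} (hg : Continuous g) {a b : ℝ} (hab : a < b) :
    ∃ r ∈ Set.Ioo a b, μ (frontier {x | g x < r}) = 0 := by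
  have hcount := Measure.countable_meas_level_set_pos (μ := μ) hg.measurable
  obtain ⟨r, hr, hr0⟩ : ∃ r ∈ Set.Ioo a b, r ∉ {t | 0 < μ {x | g x = t}} := by
    by_contra! h
    exact not_le.2 hab (Cardinal.Real.Ioo_countable_iff.1 (hcount.mono h))
  refine ⟨r, hr, measure_mono_null (frontier_lt_subset_eq hg continuous_const) ?_⟩
  simpa using hr0

lemma isPiSystem_isOpen_measure_frontier_eq_zero [TopologicalSpace X] (μ : Measure X) :
    IsPiSystem {U : Set X | IsOpen U ∧ μ (frontier U) = 0} := by
  rintro U ⟨hU, hU0⟩ V ⟨hV, hV0⟩ -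
  refine ⟨hU.inter hV, measure_mono_null (frontier_inter_subset U V) ?_⟩
  exact measure_union_null (measure_mono_null Set.inter_subset_left hU0)
    (measure_mono_null Set.inter_subset_right hV0)

end Configurations

section ClosedConfigurations

variable {X : Type*} [MetricSpace X] [MeasurableSpace X] [BorelSpace X]

lemma borel_eq_generateFrom_isOpen_measure_frontier_eq_zero [SecondCountableTopology X]
    (μ : Measure X) [SFinite μ] :
    ‹MeasurableSpace X› =
      MeasurableSpace.generateFrom {U : Set X | IsOpen U ∧ μ (frontier U) = 0} := by
  have hbasis : TopologicalSpace.IsTopologicalBasis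
      {U : Set X | IsOpen U ∧ μ (frontier U) = 0} := by
    refine TopologicalSpace.isTopologicalBasis_of_isOpen_of_nhds (fun U hU ↦ hU.1) ?_
    intro x V hx hV
    obtain ⟨ε, hε, hεV⟩ := Metric.isOpen_iff.1 hV x hx
    have hcont : Continuous fun y ↦ dist y x := continuous_id.dist continuous_const
    obtain ⟨r, hr, hr0⟩ := exists_measure_frontier_lt_eq_zero μ hcont hε
    refine ⟨{y | dist y x < r}, ⟨isOpen_lt hcont continuous_const, hr0⟩, ?_, ?_⟩
    · change dist x x < r
      rw [dist_self]
      exact hr.1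
    · exact (Metric.ball_subset_ball hr.2.le).trans hεV
  exact BorelSpace.measurable_eq.trans hbasis.borel_eq_generateFrom

lemma sFinite_M0plus (μ : M0plus X) : SFinite μ.1 := by
  have : SigmaFinite μ.1 := by
    refine ⟨⟨⟨fun n : ℕ ↦ {x | gauge x ≤ n}, fun _ ↦ trivial, fun n ↦
      μ.2 _ (measurableSet_gauge_le _) (isBounded_gauge_le _), ?_⟩⟩⟩
    exact Set.eq_univ_of_forall fun x ↦ Set.mem_iUnion.2 (exists_nat_ge (gauge x))
  infer_instance

/-- On a bounded open set with null boundary, a vague limit of configurations is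
integer-valued. -/
lemma apply_mem_range_toENNReal_of_mem_closure {μ : M0plus X}
    (hμ : μ ∈ closure {ν : M0plus X | IsConfiguration ν.1}) {U : Set X} (hU : IsOpen U)
    (hU0 : μ.1 (frontier U) = 0) (hUb : IsBounded U) :
    μ.1 U ∈ Set.range ENat.toENNReal := by
  obtain ⟨n, hn⟩ := exists_nat_gauge_le hUb.closure
  have hUn : ∀ x ∈ U, gauge x ≤ n := fun x hx ↦ hn x (subset_closure hx)
  have hnull : (localize n μ : Measure X) (frontier U) = 0 := by
    rw [localize_apply μ isClosed_frontier.measurableSet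
      fun x hx ↦ hn x (frontier_subset_closure hx), hU0]
  have hlim : Tendsto (fun ν : M0plus X ↦ ν.1.real U)
      (𝓝[{ν : M0plus X | IsConfiguration ν.1}] μ) (𝓝 (μ.1.real U)) := by
    have h := ((tendsto_measureReal_of_null_frontier (localize n μ) hnull).comp
      ((continuous_localize n).tendsto μ)).mono_left
        (nhdsWithin_le_nhds (s := {ν : M0plus X | IsConfiguration ν.1}))
    have heq (ν : M0plus X) : (localize n ν : Measure X).real U = ν.1.real U := by
      rw [measureReal_def, measureReal_def, localize_apply ν hU.measurableSet hUn]
    simpa only [Function.comp_def, heq] using h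
  have : (𝓝[{ν : M0plus X | IsConfiguration ν.1}] μ).NeBot :=
    mem_closure_iff_nhdsWithin_neBot.1 hμ
  obtain ⟨k, hk⟩ : μ.1.real U ∈ Set.range ((↑) : ℕ → ℝ) := by
    refine Nat.isClosedEmbedding_coe_real.isClosed_range.mem_of_tendsto hlim ?_
    filter_upwards [self_mem_nhdsWithin] with ν hν
    rcases hν.1 U hU.measurableSet with h | ⟨k, hk⟩
    · exact absurd h (ν.2 U hU.measurableSet hUb).ne
    · exact ⟨k, by rw [measureReal_def, hk, ENNReal.toReal_natCast]⟩
  refine ⟨k, ?_⟩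
  rw [ENat.toENNReal_coe, ← ENNReal.ofReal_natCast, hk,
    ofReal_measureReal (μ.2 U hU.measurableSet hUb).ne]

lemma isClosed_isConfiguration [TopologicalSpace.SeparableSpace X] :
    IsClosed {μ : M0plus X | IsConfiguration μ.1} := by
  have := UniformSpace.secondCountable_of_separable X
  refine isClosed_of_closure_subset fun μ hμ ↦ ⟨fun B hB ↦ ?_, μ.2⟩
  have := sFinite_M0plus μ
  have hr (n : ℕ) := exists_measure_frontier_lt_eq_zero μ.1 continuous_gauge
    (lt_add_one (n : ℝ))
  choose r hr hr0 using hr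
  let D : ℕ → Set X := fun n ↦ {x | gauge x < r n}
  have hDo (n : ℕ) : IsOpen (D n) := isOpen_lt continuous_gauge continuous_const
  have hDb (n : ℕ) : IsBounded (D n) :=
    (isBounded_gauge_le (r n)).subset fun x hx ↦ le_of_lt (α := ℝ) hx
  have hDmono : Monotone D := by
    refine monotone_nat_of_le_succ fun n x hx ↦ ?_
    have h1 := (hr n).2
    have h2 := (hr (n + 1)).1
    push_cast at h2
    exact lt_trans (α := ℝ) hx (h1.trans h2)
  have hDunion : ⋃ n, B ∩ D n = B := by
    rw [← Set.inter_iUnion]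
    refine Set.inter_eq_left.2 fun x _ ↦ ?_
    obtain ⟨n, hn⟩ := exists_nat_ge (gauge x)
    exact Set.mem_iUnion.2 ⟨n, lt_of_le_of_lt hn (hr n).1⟩
  have hlim : Tendsto (fun n ↦ μ.1 (B ∩ D n)) atTop (𝓝 (μ.1 B)) := by
    have h := tendsto_measure_iUnion_atTop (μ := μ.1) (s := fun n ↦ B ∩ D n)
      fun m n hmn ↦ Set.inter_subset_inter_right B (hDmono hmn)
    rwa [hDunion] at h
  refine mem_range_toENNReal_iff.1
    (ENat.isClosedEmbedding_toENNReal.isClosed_range.mem_of_tendsto hlim (.of_forall fun n ↦ ?_))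
  have hpi := isPiSystem_isOpen_measure_frontier_eq_zero μ.1
  refine measure_inter_mem_range_toENNReal
    (borel_eq_generateFrom_isOpen_measure_frontier_eq_zero μ.1) hpi (hDo n).measurableSet
    (μ.2 _ (hDo n).measurableSet (hDb n)).ne
    (apply_mem_range_toENNReal_of_mem_closure hμ (hDo n) (hr0 n) (hDb n)) ?_ hB
  intro A hA
  rcases Set.eq_empty_or_nonempty (A ∩ D n) with h | h
  · rw [h, measure_empty]
    exact ⟨0, ENat.toENNReal_zero⟩
  · have hAD := hpi A hA (D n) ⟨hDo n, hr0 n⟩ h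
    exact apply_mem_range_toENNReal_of_mem_closure hμ hAD.1 hAD.2
      ((hDb n).subset Set.inter_subset_right)

end ClosedConfigurations

/-- The set of configurations is closed in `M₀⁺(X)` for the
vague topology; in particular it is Polish for the subspace topology. -/
theorem configurations_closed_and_polish
    (X : Type*) [MetricSpace X] [CompleteSpace X] [TopologicalSpace.SeparableSpace X]
    [MeasurableSpace X] [BorelSpace X] :
    IsClosed {μ : M0plus X | IsConfiguration μ.1} ∧
      PolishSpace {μ : M0plus X | IsConfiguration μ.1} :=
  ⟨isClosed_isConfiguration, isClosed_isConfiguration.polishSpace⟩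

end PoissonTransport
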